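/- arXiv:2110.08106 — 5 statements merged into one kernel-verified Lean document; each statement's English description precedes it below -/
import Mathlib

section
/- If a binary matrix M is d-twin-ordered, then M is (2d+2)-mixed-free. -/
/- A binary matrix with `n` rows and `m` columns is modelled as `M : ℕ → ℕ → Bool`,
with the relevant entries `M x y` for `x < n`, `y < m`. Generalized submatrices are
described by a row-index predicate `P` and a column-index predicate `Q`. -/

/-- The submatrix of `M` with rows `P` and columns `Q` is horizontal:
all its columns are equal (equivalently, all its rows are constant). -/
def IsHoriz (M : ℕ → ℕ → Bool) (P Q : ℕ → Prop) : Prop :=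
  ∀ x y y', P x → Q y → Q y' → M x y = M x y'

/-- The submatrix of `M` with rows `P` and columns `Q` is vertical:
all its rows are equal (equivalently, all its columns are constant). -/
def IsVert (M : ℕ → ℕ → Bool) (P Q : ℕ → Prop) : Prop :=
  ∀ x x' y, P x → P x' → Q y → M x y = M x' y

/-- The submatrix of `M` with rows `P` and columns `Q` is constant. -/
def IsConst (M : ℕ → ℕ → Bool) (P Q : ℕ → Prop) : Prop :=
  ∀ x y x' y', P x → Q y → P x' → Q y' → M x y = M x' y'

/-- Mixed: neither horizontal nor vertical. -/
def IsMixed (M : ℕ → ℕ → Bool) (P Q : ℕ → Prop) : Prop :=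
  ¬ IsHoriz M P Q ∧ ¬ IsVert M P Q

/-- A partition of the index interval `[0,n)` into consecutive nonempty blocks is recorded
by its finite set `S` of block starts: it must contain `0` and have all elements `< n`. -/
def IsPartition (n : ℕ) (S : Finset ℕ) : Prop :=
  0 ∈ S ∧ ∀ s ∈ S, s < n

/-- `x` belongs to the block of the partition (of `[0,n)`) with starts `S`
that starts at `s`: `s ≤ x < n`, and no start of `S` lies in `(s, x]`. -/
def InBlock (S : Finset ℕ) (n s x : ℕ) : Prop :=
  x < n ∧ s ≤ x ∧ ∀ t ∈ S, t ≤ x → t ≤ s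

/-- The division of the `n × m` matrix `M` given by row-block starts `R` and
column-block starts `C` has error value at most `d`: every row block and every
column block contains at most `d` non-constant zones. -/
def ErrorValueLe (M : ℕ → ℕ → Bool) (n m : ℕ) (R C : Finset ℕ) (d : ℕ) : Prop :=
  (∀ sr ∈ R, {sc | sc ∈ C ∧ ¬ IsConst M (InBlock R n sr) (InBlock C m sc)}.ncard ≤ d) ∧
  (∀ sc ∈ C, {sr | sr ∈ R ∧ ¬ IsConst M (InBlock R n sr) (InBlock C m sc)}.ncard ≤ d)

/-- The `n × m` binary matrix `M` is `d`-twin-ordered: there is a contraction sequence,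
from the finest division to the coarsest one, each division being obtained from the
previous one by merging two consecutive row blocks or two consecutive column blocks
(i.e. deleting one block start), in which every division has error value at most `d`. -/
def TwinOrdered (n m d : ℕ) (M : ℕ → ℕ → Bool) : Prop :=
  ∃ D : ℕ → Finset ℕ × Finset ℕ,
    D 0 = (Finset.range n, Finset.range m) ∧
    D ((n - 1) + (m - 1)) = ({0}, {0}) ∧
    (∀ k, k < (n - 1) + (m - 1) →
      ((D (k+1)).1 ⊆ (D k).1 ∧ (D k).1.card = (D (k+1)).1.card + 1 ∧
        (D (k+1)).2 = (D k).2) ∨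
      ((D (k+1)).2 ⊆ (D k).2 ∧ (D k).2.card = (D (k+1)).2.card + 1 ∧
        (D (k+1)).1 = (D k).1)) ∧
    (∀ k, k ≤ (n - 1) + (m - 1) → ErrorValueLe M n m (D k).1 (D k).2 d)

/-- A `t`-mixed minor in the `n × m` matrix `M`: a `t`-division all of whose zones are mixed. -/
def HasMixedMinor (M : ℕ → ℕ → Bool) (n m t : ℕ) : Prop :=
  ∃ R C : Finset ℕ, IsPartition n R ∧ IsPartition m C ∧ R.card = t ∧ C.card = t ∧
    ∀ sr ∈ R, ∀ sc ∈ C, IsMixed M (InBlock R n sr) (InBlock C m sc)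

/-- `M` (as an `n × m` matrix) is `t`-mixed-free: it has no `t`-mixed minor. -/
def MixedFree (M : ℕ → ℕ → Bool) (n m t : ℕ) : Prop := ¬ HasMixedMinor M n m t

/-- Some block of the partition `T` of `[0,n)` is contained in a block of the partition `S`. -/
def ContainsBlock (n : ℕ) (S T : Finset ℕ) : Prop :=
  ∃ s ∈ S, ∃ r ∈ T, ∀ x, InBlock T n r x → InBlock S n s x

theorem exists_inBlock {S : Finset ℕ} {n x : ℕ} (h0 : 0 ∈ S) (hx : x < n) :
    ∃ s ∈ S, InBlock S n s x := by
  have hne : (S.filter (· ≤ x)).Nonempty := ⟨0, by simp [h0]⟩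
  have hmem := Finset.max'_mem _ hne
  rw [Finset.mem_filter] at hmem
  exact ⟨_, hmem.1, hx, hmem.2, fun t ht htx =>
    Finset.le_max' _ _ (Finset.mem_filter.2 ⟨ht, htx⟩)⟩

theorem InBlock.lt_of_lt {S : Finset ℕ} {n s t x : ℕ} (h : InBlock S n s x) (ht : t ∈ S)
    (hst : s < t) : x < t := by
  by_contra! hle
  exact (h.2.2 t ht hle).not_gt hst

/-- If a block of `U` meets three blocks of `C`, it contains the middle one. -/
theorem containsBlock_of_meets_three {m : ℕ} {U C : Finset ℕ} {u a b c y z : ℕ}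
    (hu : u ∈ U) (hb : b ∈ C) (hc : c ∈ C) (hab : a < b) (hbc : b < c)
    (hy : InBlock C m a y) (hz : InBlock C m c z)
    (huy : InBlock U m u y) (huz : InBlock U m u z) : ContainsBlock m U C := by
  refine ⟨u, hu, b, hb, fun x hx => ⟨hx.1, ?_, fun t ht htx => huz.2.2 t ht ?_⟩⟩
  · exact huy.2.1.trans ((hy.lt_of_lt hb hab).le.trans hx.2.1)
  · exact htx.trans ((hx.lt_of_lt hc hbc).le.trans hz.2.1)

/-- A row block containing a row set that forms a non-vertical zone with every block of `C`
contains at least `C.card / 2` non-constant zones, provided no block of `U` contains a block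
of `C`. -/
theorem card_le_two_mul_ncard (M : ℕ → ℕ → Bool) (m : ℕ) {P Q : ℕ → Prop} {U C : Finset ℕ}
    (h0 : 0 ∈ U) (hPQ : ∀ x, P x → Q x) (hUC : ¬ ContainsBlock m U C)
    (hM : ∀ c ∈ C, ¬ IsVert M P (InBlock C m c)) :
    C.card ≤ 2 * {u | u ∈ U ∧ ¬ IsConst M Q (InBlock U m u)}.ncard := by
  classical
  have key : ∀ c ∈ C, ∃ u ∈ U, ¬ IsConst M Q (InBlock U m u) ∧
      ∃ y, InBlock C m c y ∧ InBlock U m u y := by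
    intro c hc
    have hv := hM c hc
    unfold IsVert at hv
    push Not at hv
    obtain ⟨x, x', y, hx, hx', hy, hne⟩ := hv
    obtain ⟨u, hu, huy⟩ := exists_inBlock h0 hy.1
    exact ⟨u, hu, fun hK => hne (hK x y x' y (hPQ x hx) huy (hPQ x' hx') huy), y, hy, huy⟩
  choose! f hfU hfK g hgC hgU using key
  have hset : {u | u ∈ U ∧ ¬ IsConst M Q (InBlock U m u)} =
      (U.filter fun u => ¬ IsConst M Q (InBlock U m u) : Finset ℕ) := by
    ext; simp
  rw [hset, Set.ncard_coe_finset]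
  refine Finset.card_le_mul_card_image_of_maps_to (f := f)
    (fun c hc => Finset.mem_filter.2 ⟨hfU c hc, hfK c hc⟩) 2 fun u _ => ?_
  have ordered : ∀ a b c, a ∈ C → b ∈ C → c ∈ C → f a = u → f c = u → a < b → ¬ b < c := by
    intro a b c ha hb hc hau hcu hab hbc
    exact hUC (containsBlock_of_meets_three (hau ▸ hfU a ha) hb hc hab hbc (hgC a ha) (hgC c hc)
      (hau ▸ hgU a ha) (hcu ▸ hgU c hc))
  by_contra! h2
  obtain ⟨a, b, c, ha, hb, hc, hab, hac, hbc⟩ := Finset.two_lt_card_iff.1 h2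
  simp only [Finset.mem_filter] at ha hb hc
  grind

theorem InBlock.eq_of_range {n s x : ℕ} (h : InBlock (Finset.range n) n s x) : x = s :=
  le_antisymm (h.2.2 x (Finset.mem_range.2 h.1) le_rfl) h.2.1

theorem not_containsBlock_range {n : ℕ} {T : Finset ℕ}
    (h : ∀ r ∈ T, ∃ x x', InBlock T n r x ∧ InBlock T n r x' ∧ x ≠ x') :
    ¬ ContainsBlock n (Finset.range n) T := by
  rintro ⟨s, -, r, hr, hsub⟩
  obtain ⟨x, x', hx, hx', hne⟩ := h r hr
  exact hne ((hsub x hx).eq_of_range.trans (hsub x' hx').eq_of_range.symm)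

theorem containsBlock_singleton_zero {n : ℕ} {T : Finset ℕ} (h0 : 0 ∈ T) :
    ContainsBlock n {0} T :=
  ⟨0, by simp, 0, h0, fun x hx => ⟨hx.1, x.zero_le, by simp⟩⟩

theorem IsMixed.exists_row_ne {M : ℕ → ℕ → Bool} {P Q : ℕ → Prop} (h : IsMixed M P Q) :
    ∃ x x', P x ∧ P x' ∧ x ≠ x' := by
  by_contra! hP
  exact h.2 fun x x' y hx hx' _ => by rw [hP x x' hx hx']

theorem IsMixed.exists_col_ne {M : ℕ → ℕ → Bool} {P Q : ℕ → Prop} (h : IsMixed M P Q) :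
    ∃ y y', Q y ∧ Q y' ∧ y ≠ y' := by
  by_contra! hQ
  exact h.1 fun x y y' _ hy hy' => by rw [hQ y y' hy hy']

theorem isConst_swap {M : ℕ → ℕ → Bool} {P Q : ℕ → Prop} :
    IsConst (fun x y => M y x) P Q ↔ IsConst M Q P :=
  ⟨fun h x y x' y' hx hy hx' hy' => h y x y' x' hy hx hy' hx',
    fun h x y x' y' hx hy hx' hy' => h y x y' x' hy hx hy' hx'⟩

theorem isVert_swap {M : ℕ → ℕ → Bool} {P Q : ℕ → Prop} :
    IsVert (fun x y => M y x) P Q ↔ IsHoriz M Q P :=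
  ⟨fun h x y y' hx hy hy' => h y y' x hy hy' hx, fun h x x' y hx hx' hy => h y x x' hy hx hx'⟩

/-- If a binary matrix is `d`-twin-ordered, then it is `(2d+2)`-mixed-free. -/
theorem twinOrdered_implies_mixedFree (d n m : ℕ) (M : ℕ → ℕ → Bool)
    (h : TwinOrdered n m d M) : MixedFree M n m (2 * d + 2) := by
  obtain ⟨D, hD0, hDN, hstep, herr⟩ := h
  rintro ⟨R, C, hR, hC, hRcard, hCcard, hmix⟩
  have hzero : ∀ k ≤ (n - 1) + (m - 1), 0 ∈ (D k).1 ∧ 0 ∈ (D k).2 := by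
    intro k hk
    induction hk using Nat.decreasingInduction with
    | self => simp [hDN]
    | of_succ k hk ih =>
      rcases hstep k hk with ⟨hsub, -, heq⟩ | ⟨hsub, -, heq⟩
      · exact ⟨hsub ih.1, heq ▸ ih.2⟩
      · exact ⟨heq ▸ ih.1, hsub ih.2⟩
  have hrow : ∀ k ≤ (n - 1) + (m - 1), ContainsBlock n (D k).1 R →
      ContainsBlock m (D k).2 C := by
    rintro k hk ⟨s, hs, r, hr, hsub⟩
    by_contra hUC
    have hcount := card_le_two_mul_ncard M m (hzero k hk).2 hsub hUC
      fun c hc => (hmix r hr c hc).2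
    have := (herr k hk).1 s hs
    omega
  have hcol : ∀ k ≤ (n - 1) + (m - 1), ContainsBlock m (D k).2 C →
      ContainsBlock n (D k).1 R := by
    rintro k hk ⟨s, hs, c, hc, hsub⟩
    by_contra hUR
    have hcount := card_le_two_mul_ncard (fun x y => M y x) n (hzero k hk).1 hsub hUR
      fun r hr hv => (hmix r hr c hc).1 (isVert_swap.1 hv)
    simp only [isConst_swap] at hcount
    have := (herr k hk).2 s hs
    omega
  have hnone : ∀ k ≤ (n - 1) + (m - 1),
      ¬ ContainsBlock n (D k).1 R ∧ ¬ ContainsBlock m (D k).2 C := by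
    intro k
    induction k with
    | zero =>
      intro _
      rw [hD0]
      exact ⟨not_containsBlock_range fun r hr => (hmix r hr 0 hC.1).exists_row_ne,
        not_containsBlock_range fun c hc => (hmix 0 hR.1 c hc).exists_col_ne⟩
    | succ k ih =>
      intro hk
      have ihk := ih (Nat.le_of_succ_le hk)
      rcases hstep k hk with ⟨-, -, heq⟩ | ⟨-, -, heq⟩
      · have hn : ¬ ContainsBlock m (D (k + 1)).2 C := heq ▸ ihk.2
        exact ⟨fun hc => hn (hrow _ hk hc), hn⟩
      · have hn : ¬ ContainsBlock n (D (k + 1)).1 R := heq ▸ ihk.1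
        exact ⟨hn, fun hc => hn (hcol _ hk hc)⟩
  have hlast := (hnone _ le_rfl).1
  rw [hDN] at hlast
  exact hlast (containsBlock_singleton_zero hR.1)
end

section
/- A matrix is mixed if and only if it contains a corner. -/
/-- A corner of `M` at position `(r, c)`: the `2 × 2` submatrix on rows `r, r+1`
and columns `c, c+1` is mixed. -/
def Corner (M : ℕ → ℕ → Bool) (r c : ℕ) : Prop :=
  IsMixed M (fun x => x = r ∨ x = r + 1) (fun y => y = c ∨ y = c + 1)

theorem corner_iff (M : ℕ → ℕ → Bool) (r c : ℕ) :
    Corner M r c ↔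
      ¬ (M r c = M r (c + 1) ∧ M (r + 1) c = M (r + 1) (c + 1)) ∧
      ¬ (M r c = M (r + 1) c ∧ M r (c + 1) = M (r + 1) (c + 1)) := by
  refine and_congr (not_congr ⟨fun h => ?_, ?_⟩) (not_congr ⟨fun h => ?_, ?_⟩)
  · exact ⟨h _ _ _ (.inl rfl) (.inl rfl) (.inr rfl), h _ _ _ (.inr rfl) (.inl rfl) (.inr rfl)⟩
  · rintro ⟨h, h'⟩ x y y' (rfl | rfl) (rfl | rfl) (rfl | rfl) <;> simp [h, h']
  · exact ⟨h _ _ _ (.inl rfl) (.inr rfl) (.inl rfl), h _ _ _ (.inl rfl) (.inr rfl) (.inr rfl)⟩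
  · rintro ⟨h, h'⟩ x x' y (rfl | rfl) (rfl | rfl) (rfl | rfl) <;> simp [h, h']

/-- A function on an integer interval that agrees on consecutive points is constant. -/
theorem eq_of_forall_eq_succ {α : Type*} {f : ℕ → α} {a b : ℕ}
    (h : ∀ x, a ≤ x → x + 1 ≤ b → f x = f (x + 1)) {x y : ℕ}
    (hx : a ≤ x ∧ x ≤ b) (hy : a ≤ y ∧ y ≤ b) : f x = f y := by
  have key : ∀ z, a ≤ z → z ≤ b → f a = f z := by
    intro z hz
    induction z, hz using Nat.le_induction with
    | base => exact fun _ => rfl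
    | succ z hz ih => exact fun hb => (ih (by omega)).trans (h z hz hb)
  exact (key x hx.1 hx.2).symm.trans (key y hy.1 hy.2)

/-- A matrix (here: the submatrix of `M` on rows `[r1, r2]` and columns `[c1, c2]`)
is mixed if and only if it contains a corner. -/
theorem mixed_iff_contains_corner (M : ℕ → ℕ → Bool) (r1 r2 c1 c2 : ℕ) :
    IsMixed M (fun x => r1 ≤ x ∧ x ≤ r2) (fun y => c1 ≤ y ∧ y ≤ c2) ↔
      ∃ r c, r1 ≤ r ∧ r + 1 ≤ r2 ∧ c1 ≤ c ∧ c + 1 ≤ c2 ∧ Corner M r c := by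
  constructor
  · rintro ⟨hH, hV⟩
    by_contra! hN
    simp only [corner_iff] at hN
    obtain ⟨x, c, hx, hc, hc', hxc⟩ :
        ∃ x c, (r1 ≤ x ∧ x ≤ r2) ∧ c1 ≤ c ∧ c + 1 ≤ c2 ∧ M x c ≠ M x (c + 1) := by
      by_contra! h
      exact hH fun x y y' hx hy hy' => eq_of_forall_eq_succ (fun c => h x c hx) hy hy'
    obtain ⟨r, y, hy, hr, hr', hry⟩ :
        ∃ r y, (c1 ≤ y ∧ y ≤ c2) ∧ r1 ≤ r ∧ r + 1 ≤ r2 ∧ M r y ≠ M (r + 1) y := by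
      by_contra! h
      exact hV fun x x' y hx hx' hy =>
        eq_of_forall_eq_succ (f := fun r => M r y) (fun r => h r y hy) hx hx'
    have hrow : (M x c = M x (c + 1)) = (M r c = M r (c + 1)) :=
      eq_of_forall_eq_succ (f := fun x => M x c = M x (c + 1))
        (fun z hz hz' => by have := hN z c hz hz' hc hc'; grind) hx ⟨hr, by omega⟩
    have hcol : (M r y = M (r + 1) y) = (M r c = M (r + 1) c) :=
      eq_of_forall_eq_succ (f := fun y => M r y = M (r + 1) y)
        (fun z hz hz' => by have := hN r z hr hr' hz hz'; grind) hy ⟨hc, by omega⟩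
    exact hN r c hr hr' hc hc' ⟨fun h => hxc (hrow.mpr h.1), fun h => hry (hcol.mpr h.1)⟩
  · rintro ⟨r, c, hr, hr', hc, hc', hH, hV⟩
    refine ⟨fun h => hH fun x y y' hx hy hy' => h x y y' ?_ ?_ ?_,
      fun h => hV fun x x' y hx hx' hy => h x x' y ?_ ?_ ?_⟩ <;> dsimp only at * <;> omega
end

section
/- Let M be an n×n binary matrix that is d-twin-ordered. Then M admits a rectangle decomposition K with |K| ≤ d·(2n−2)+1. -/
/-- `(x, y)` is an entry of the rectangle `q = (r1, r2, c1, c2)`,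
i.e. `r1 ≤ x ≤ r2` and `c1 ≤ y ≤ c2`. -/
def InRect (q : ℕ × ℕ × ℕ × ℕ) (x y : ℕ) : Prop :=
  q.1 ≤ x ∧ x ≤ q.2.1 ∧ q.2.2.1 ≤ y ∧ y ≤ q.2.2.2

/-- The region `A` is the union of at most `m` pairwise disjoint rectangles inside `[0,n)²`. -/
def IsRectUnion (n : ℕ) (A : ℕ → ℕ → Prop) (m : ℕ) : Prop :=
  ∃ K : Finset (ℕ × ℕ × ℕ × ℕ),
    (∀ q ∈ K, q.1 ≤ q.2.1 ∧ q.2.1 < n ∧ q.2.2.1 ≤ q.2.2.2 ∧ q.2.2.2 < n) ∧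
    (∀ q ∈ K, ∀ q' ∈ K, q ≠ q' → ∀ x y, ¬(InRect q x y ∧ InRect q' x y)) ∧
    (∀ x y, A x y ↔ ∃ q ∈ K, InRect q x y) ∧
    K.card ≤ m

theorem IsRectUnion.congr {n m : ℕ} {A B : ℕ → ℕ → Prop} (h : IsRectUnion n A m)
    (hAB : ∀ x y, A x y ↔ B x y) : IsRectUnion n B m := by
  obtain ⟨K, h1, h2, h3, h4⟩ := h
  exact ⟨K, h1, h2, fun x y => (hAB x y).symm.trans (h3 x y), h4⟩

theorem IsRectUnion.mono {n m m' : ℕ} {A : ℕ → ℕ → Prop} (h : IsRectUnion n A m)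
    (hm : m ≤ m') : IsRectUnion n A m' := by
  obtain ⟨K, h1, h2, h3, h4⟩ := h
  exact ⟨K, h1, h2, h3, h4.trans hm⟩

theorem isRectUnion_empty (n m : ℕ) {A : ℕ → ℕ → Prop} (hA : ∀ x y, ¬ A x y) :
    IsRectUnion n A m :=
  ⟨∅, by simp, by simp, by simpa using hA, by simp⟩

theorem IsRectUnion.swap {n m : ℕ} {A : ℕ → ℕ → Prop} (h : IsRectUnion n A m) :
    IsRectUnion n (fun x y => A y x) m := by
  obtain ⟨K, h1, h2, h3, h4⟩ := h
  refine ⟨K.image (fun q => (q.2.2.1, q.2.2.2, q.1, q.2.1)), ?_, ?_, ?_,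
    Finset.card_image_le.trans h4⟩
  · intro q hq
    obtain ⟨p, hp, rfl⟩ := Finset.mem_image.1 hq
    have := h1 p hp
    tauto
  · intro q hq q' hq' hne x y hxy
    obtain ⟨p, hp, rfl⟩ := Finset.mem_image.1 hq
    obtain ⟨p', hp', rfl⟩ := Finset.mem_image.1 hq'
    refine h2 p hp p' hp' (fun e => hne (by rw [e])) y x ?_
    simp only [InRect] at hxy ⊢
    tauto
  · intro x y
    refine (h3 y x).trans ?_
    simp only [Finset.exists_mem_image]
    refine exists_congr fun q => and_congr_right fun _ => ?_
    simp only [InRect]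
    tauto

theorem IsRectUnion.union {n a b : ℕ} {A B : ℕ → ℕ → Prop} (hA : IsRectUnion n A a)
    (hB : IsRectUnion n B b) (hAB : ∀ x y, A x y → ¬ B x y) :
    IsRectUnion n (fun x y => A x y ∨ B x y) (a + b) := by
  obtain ⟨K, h1, h2, h3, h4⟩ := hA
  obtain ⟨L, g1, g2, g3, g4⟩ := hB
  refine ⟨K ∪ L, ?_, ?_, ?_, (Finset.card_union_le _ _).trans (Nat.add_le_add h4 g4)⟩
  · intro q hq
    rcases Finset.mem_union.1 hq with hq | hq
    · exact h1 q hq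
    · exact g1 q hq
  · rintro q hq q' hq' hne x y ⟨hx, hx'⟩
    rcases Finset.mem_union.1 hq with hq | hq <;> rcases Finset.mem_union.1 hq' with hq' | hq'
    · exact h2 q hq q' hq' hne x y ⟨hx, hx'⟩
    · exact hAB x y ((h3 x y).2 ⟨q, hq, hx⟩) ((g3 x y).2 ⟨q', hq', hx'⟩)
    · exact hAB x y ((h3 x y).2 ⟨q', hq', hx'⟩) ((g3 x y).2 ⟨q, hq, hx⟩)
    · exact g2 q hq q' hq' hne x y ⟨hx, hx'⟩
  · intro x y
    simp only [h3, g3, Finset.mem_union, or_and_right, exists_or]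

theorem isRectUnion_biUnion {n : ℕ} (F : Finset ℕ) (B : ℕ → ℕ → ℕ → Prop)
    (hB : ∀ i ∈ F, IsRectUnion n (B i) 1)
    (hd : ∀ i ∈ F, ∀ j ∈ F, ∀ x y, B i x y → B j x y → i = j) :
    IsRectUnion n (fun x y => ∃ i ∈ F, B i x y) F.card := by
  induction F using Finset.induction_on with
  | empty => exact isRectUnion_empty n _ (by simp)
  | insert i F hi ih =>
    rw [Finset.card_insert_of_notMem hi]
    have hF := ih (fun j hj => hB j (Finset.mem_insert_of_mem hj))
      (fun j hj k hk => hd j (Finset.mem_insert_of_mem hj) k (Finset.mem_insert_of_mem hk))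
    refine (hF.union (hB i (Finset.mem_insert_self i F)) ?_).congr ?_
    · rintro x y ⟨j, hj, hjx⟩ hix
      exact hi (hd j (Finset.mem_insert_of_mem hj) i (Finset.mem_insert_self i F) x y hjx hix ▸ hj)
    · intro x y
      simp only [Finset.exists_mem_insert]
      exact or_comm

theorem InBlock.start_unique {S : Finset ℕ} {n s s' x : ℕ} (hs : s ∈ S) (hs' : s' ∈ S)
    (h : InBlock S n s x) (h' : InBlock S n s' x) : s = s' :=
  le_antisymm (h'.2.2 s hs h.2.1) (h.2.2 s' hs' h'.2.1)

theorem exists_inBlock_iff_le {S : Finset ℕ} {n s : ℕ} (hs : s < n) :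
    ∃ e, s ≤ e ∧ e < n ∧ ∀ x, InBlock S n s x ↔ s ≤ x ∧ x ≤ e := by
  classical
  have hne : ((Finset.range n).filter (InBlock S n s)).Nonempty :=
    ⟨s, Finset.mem_filter.2 ⟨Finset.mem_range.2 hs, hs, le_rfl, fun _ _ h => h⟩⟩
  have hmem := Finset.max'_mem _ hne
  have hle := fun x => Finset.le_max' ((Finset.range n).filter (InBlock S n s)) x
  set e := ((Finset.range n).filter (InBlock S n s)).max' hne
  obtain ⟨he, he', hse, ht⟩ := Finset.mem_filter.1 hmem
  refine ⟨e, hse, he', fun x => ⟨fun hx => ⟨hx.2.1, ?_⟩, fun hx => ?_⟩⟩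
  · exact hle x (Finset.mem_filter.2 ⟨Finset.mem_range.2 hx.1, hx⟩)
  · exact ⟨hx.2.trans_lt he', hx.1, fun t htS htx => ht t htS (htx.trans hx.2)⟩

theorem isRectUnion_zone {R C : Finset ℕ} {n s c : ℕ} (hs : s < n) (hc : c < n) :
    IsRectUnion n (fun x y => InBlock R n s x ∧ InBlock C n c y) 1 := by
  obtain ⟨e, h1, h2, h3⟩ := exists_inBlock_iff_le (S := R) hs
  obtain ⟨f, g1, g2, g3⟩ := exists_inBlock_iff_le (S := C) hc
  refine ⟨{(s, e, c, f)}, by simp [h1, h2, g1, g2], by simp, ?_, by simp⟩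
  intro x y
  simp only [Finset.mem_singleton, exists_eq_left, h3, g3, InRect, and_assoc]

theorem inBlock_insert_subset {S : Finset ℕ} {n s t u x : ℕ}
    (hst : InBlock S n s t) (hx : InBlock (insert t S) n u x) :
    InBlock S n (if u = t then s else u) x := by
  obtain ⟨hxn, hux, hmax⟩ := hx
  split_ifs with h
  · subst h
    exact ⟨hxn, hst.2.1.trans hux, fun v hv hvx =>
      hst.2.2 v hv (hmax v (Finset.mem_insert_of_mem hv) hvx)⟩
  · exact ⟨hxn, hux, fun v hv hvx => hmax v (Finset.mem_insert_of_mem hv) hvx⟩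

theorem inBlock_insert_of_ne {S : Finset ℕ} {n s t u x : ℕ} (hsS : s ∈ S)
    (hst : InBlock S n s t) (hu : u ∈ S) (hus : u ≠ s) (hx : InBlock S n u x) :
    InBlock (insert t S) n u x := by
  obtain ⟨hxn, hux, hmax⟩ := hx
  refine ⟨hxn, hux, fun v hv hvx => ?_⟩
  rcases Finset.mem_insert.1 hv with rfl | hv
  · by_contra! hlt
    have h1 := hst.2.2 u hu hlt.le
    have h2 := hmax s hsS (hst.2.1.trans hvx)
    omega
  · exact hmax v hv hvx

theorem inBlock_insert_self_or {S : Finset ℕ} {n s t x : ℕ} (hx : InBlock S n s x) :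
    InBlock (insert t S) n s x ∨ InBlock (insert t S) n t x := by
  obtain ⟨hxn, hsx, hmax⟩ := hx
  by_cases h : t ≤ x ∧ s ≤ t
  · refine Or.inr ⟨hxn, h.1, fun v hv hvx => ?_⟩
    rcases Finset.mem_insert.1 hv with rfl | hv
    · exact le_rfl
    · exact (hmax v hv hvx).trans h.2
  · refine Or.inl ⟨hxn, hsx, fun v hv hvx => ?_⟩
    rcases Finset.mem_insert.1 hv with rfl | hv
    · omega
    · exact hmax v hv hvx

/-- The entries lying in a constant zone of the division `(R, C)` filled with `1`s. -/
def ConstOnes (M : ℕ → ℕ → Bool) (n : ℕ) (R C : Finset ℕ) (x y : ℕ) : Prop :=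
  ∃ r ∈ R, ∃ c ∈ C, InBlock R n r x ∧ InBlock C n c y ∧ M x y = true ∧
    IsConst M (InBlock R n r) (InBlock C n c)

theorem isConst_transpose (M : ℕ → ℕ → Bool) (P Q : ℕ → Prop) :
    IsConst (fun x y => M y x) Q P ↔ IsConst M P Q :=
  ⟨fun h x y x' y' a b c d => h y x y' x' b a d c,
    fun h x y x' y' a b c d => h y x y' x' b a d c⟩

theorem constOnes_transpose (M : ℕ → ℕ → Bool) (n : ℕ) (R C : Finset ℕ) (x y : ℕ) :
    ConstOnes (fun x y => M y x) n C R y x ↔ ConstOnes M n R C x y := by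
  constructor
  · rintro ⟨c, hc, r, hr, h1, h2, h3, h4⟩
    exact ⟨r, hr, c, hc, h2, h1, h3, (isConst_transpose M _ _).1 h4⟩
  · rintro ⟨r, hr, c, hc, h1, h2, h3, h4⟩
    exact ⟨c, hc, r, hr, h2, h1, h3, (isConst_transpose M _ _).2 h4⟩

/-- Splitting a row block with at most `d` non-constant zones creates at most `d` new constant
zones filled with `1`s. -/
theorem IsRectUnion.constOnes_insert {M : ℕ → ℕ → Bool} {n m d t : ℕ} {R C : Finset ℕ}
    (hR : IsPartition n R) (hC : IsPartition n C) (htn : t < n)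
    (hd : ∀ r ∈ R, {c | c ∈ C ∧ ¬ IsConst M (InBlock R n r) (InBlock C n c)}.ncard ≤ d)
    (h : IsRectUnion n (ConstOnes M n R C) m) :
    IsRectUnion n (ConstOnes M n (insert t R) C) (m + d) := by
  classical
  obtain ⟨s, hsR, hst⟩ := exists_inBlock hR.1 htn
  have hsub : ∀ u ∈ ({s, t} : Finset ℕ), ∀ x, InBlock (insert t R) n u x → InBlock R n s x := by
    intro u hu x hx
    have hu' : u = s ∨ u = t := by simpa using hu
    have := inBlock_insert_subset hst hx
    rcases hu' with rfl | rfl <;> simpa using this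
  let F := C.filter fun c => ¬ IsConst M (InBlock R n s) (InBlock C n c)
  have hF : F.card ≤ d := by
    refine le_trans (le_of_eq ?_) (hd s hsR)
    rw [← Set.ncard_coe_finset]
    simp [F]
  let B : ℕ → ℕ → ℕ → Prop := fun c x y => ∃ u ∈ ({s, t} : Finset ℕ),
    InBlock (insert t R) n u x ∧ InBlock C n c y ∧ M x y = true ∧
      IsConst M (InBlock (insert t R) n u) (InBlock C n c)
  have hB : ∀ c ∈ F, IsRectUnion n (B c) 1 := by
    intro c hc
    obtain ⟨hcC, hcc⟩ := Finset.mem_filter.1 hc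
    by_cases hne : ∃ x y, B c x y
    · obtain ⟨x₀, y₀, u, hu, hx₀, hy₀, hM, hconst⟩ := hne
      have hun : u < n := hx₀.2.1.trans_lt hx₀.1
      refine (isRectUnion_zone (R := insert t R) (C := C) hun (hC.2 c hcC)).congr fun x y => ?_
      refine ⟨fun ⟨hx, hy⟩ => ⟨u, hu, hx, hy, (hconst _ _ _ _ hx hy hx₀ hy₀).trans hM, hconst⟩,
        ?_⟩
      rintro ⟨v, hv, hx, hy, hM', hconst'⟩
      refine ⟨?_, hy⟩
      by_cases huv : v = u
      · exact huv ▸ hx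
      · refine absurd ?_ hcc
        have hone : ∀ x' y', InBlock R n s x' → InBlock C n c y' → M x' y' = true := by
          intro x' y' hx' hy'
          have hw : InBlock (insert t R) n u x' ∨ InBlock (insert t R) n v x' := by
            have := inBlock_insert_self_or (t := t) hx'
            have hu' : u = s ∨ u = t := by simpa using hu
            have hv' : v = s ∨ v = t := by simpa using hv
            rcases hu' with rfl | rfl <;> rcases hv' with rfl | rfl <;> tauto
          rcases hw with hw | hw
          · exact (hconst _ _ _ _ hw hy' hx₀ hy₀).trans hM
          · exact (hconst' _ _ _ _ hw hy' hx hy).trans hM'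
        intro a b a' b' ha hb ha' hb'
        rw [hone a b ha hb, hone a' b' ha' hb']
    · exact isRectUnion_empty n 1 fun x y hxy => hne ⟨x, y, hxy⟩
  have hBF := isRectUnion_biUnion F B hB (by
    rintro i hi j hj x y ⟨_, _, _, hy, _⟩ ⟨_, _, _, hy', _⟩
    exact InBlock.start_unique (Finset.mem_filter.1 hi).1 (Finset.mem_filter.1 hj).1 hy hy')
  refine ((h.union hBF ?_).congr fun x y => ?_).mono (Nat.add_le_add_left hF m)
  · rintro x y ⟨r, hr, c, hc, hx, hy, -, hconst⟩ ⟨c', hc', u, hu, hx', hy', -, -⟩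
    obtain ⟨hcC', hcc'⟩ := Finset.mem_filter.1 hc'
    obtain rfl := InBlock.start_unique hr hsR hx (hsub u hu x hx')
    obtain rfl := InBlock.start_unique hc hcC' hy hy'
    exact hcc' hconst
  · constructor
    · rintro (⟨r, hr, c, hc, hx, hy, hM, hconst⟩ | ⟨c, hc, u, hu, hx, hy, hM, hconst⟩)
      · obtain ⟨u, hu, hux⟩ :=
          exists_inBlock (S := insert t R) (Finset.mem_insert_of_mem hR.1) hx.1
        have hmem : (if u = t then s else u) ∈ R := by
          split_ifs with h
          · exact hsR
          · exact (Finset.mem_insert.1 hu).resolve_left h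
        have hr' := InBlock.start_unique hmem hr (inBlock_insert_subset hst hux) hx
        refine ⟨u, hu, c, hc, hux, hy, hM, fun a b a' b' ha hb ha' hb' => ?_⟩
        exact hconst a b a' b' (hr' ▸ inBlock_insert_subset hst ha) hb
          (hr' ▸ inBlock_insert_subset hst ha') hb'
      · refine ⟨u, ?_, c, (Finset.mem_filter.1 hc).1, hx, hy, hM, hconst⟩
        have hu' : u = s ∨ u = t := by simpa using hu
        rcases hu' with rfl | rfl <;> simp [hsR]
    · rintro ⟨u, hu, c, hc, hx, hy, hM, hconst⟩
      by_cases hust : u ∈ ({s, t} : Finset ℕ)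
      · by_cases hcc : IsConst M (InBlock R n s) (InBlock C n c)
        · exact Or.inl ⟨s, hsR, c, hc, hsub u hust x hx, hy, hM, hcc⟩
        · exact Or.inr ⟨c, Finset.mem_filter.2 ⟨hc, hcc⟩, u, hust, hx, hy, hM, hconst⟩
      · have hus : u ≠ s ∧ u ≠ t := by simpa using hust
        have huR : u ∈ R := (Finset.mem_insert.1 hu).resolve_left hus.2
        have hx' := inBlock_insert_subset hst hx
        rw [if_neg hus.2] at hx'
        exact Or.inl ⟨u, huR, c, hc, hx', hy, hM, fun a b a' b' ha hb ha' hb' =>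
          hconst a b a' b' (inBlock_insert_of_ne hsR hst huR hus.1 ha) hb
            (inBlock_insert_of_ne hsR hst huR hus.1 ha') hb'⟩

theorem IsRectUnion.constOnes_split_rows {M : ℕ → ℕ → Bool} {n m d : ℕ} {R R' C : Finset ℕ}
    (hR' : IsPartition n R') (hR : IsPartition n R) (hC : IsPartition n C) (hsub : R ⊆ R')
    (hcard : R'.card = R.card + 1)
    (hd : ∀ r ∈ R, {c | c ∈ C ∧ ¬ IsConst M (InBlock R n r) (InBlock C n c)}.ncard ≤ d)
    (h : IsRectUnion n (ConstOnes M n R C) m) :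
    IsRectUnion n (ConstOnes M n R' C) (m + d) := by
  classical
  have h1 : (R' \ R).card = 1 := by rw [Finset.card_sdiff_of_subset hsub]; omega
  obtain ⟨t, ht⟩ := Finset.card_eq_one.1 h1
  have hR'eq : R' = insert t R := by
    rw [← Finset.sdiff_union_of_subset hsub, ht, Finset.singleton_union]
  subst hR'eq
  exact h.constOnes_insert hR hC (hR'.2 t (Finset.mem_insert_self t R)) hd

/-- The coarsest division has at most one constant zone filled with `1`s. -/
theorem isRectUnion_constOnes_coarsest (M : ℕ → ℕ → Bool) (n : ℕ) :
    IsRectUnion n (ConstOnes M n {0} {0}) 1 := by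
  by_cases hne : ∃ x y, ConstOnes M n {0} {0} x y
  · obtain ⟨x₀, y₀, r, hr, c, hc, hx₀, hy₀, hM, hconst⟩ := hne
    obtain rfl := Finset.mem_singleton.1 hr
    obtain rfl := Finset.mem_singleton.1 hc
    have hn : 0 < n := hx₀.2.1.trans_lt hx₀.1
    refine (isRectUnion_zone (R := {0}) (C := {0}) hn hn).congr fun x y => ⟨?_, ?_⟩
    · exact fun ⟨hx, hy⟩ => ⟨0, hr, 0, hc, hx, hy, (hconst _ _ _ _ hx hy hx₀ hy₀).trans hM, hconst⟩
    · rintro ⟨r, hr, c, hc, hx, hy, -, -⟩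
      rw [Finset.mem_singleton.1 hr] at hx
      rw [Finset.mem_singleton.1 hc] at hy
      exact ⟨hx, hy⟩
  · exact isRectUnion_empty n 1 fun x y hxy => hne ⟨x, y, hxy⟩

theorem inBlock_range {n s x : ℕ} : InBlock (Finset.range n) n s x → x = s :=
  fun ⟨hxn, hsx, hmax⟩ => le_antisymm (hmax x (Finset.mem_range.2 hxn) le_rfl) hsx

theorem constOnes_finest {M : ℕ → ℕ → Bool} {n x y : ℕ} :
    ConstOnes M n (Finset.range n) (Finset.range n) x y ↔ x < n ∧ y < n ∧ M x y = true := by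
  constructor
  · rintro ⟨r, -, c, -, hx, hy, hM, -⟩
    exact ⟨hx.1, hy.1, hM⟩
  · rintro ⟨hx, hy, hM⟩
    refine ⟨x, Finset.mem_range.2 hx, y, Finset.mem_range.2 hy, ⟨hx, le_rfl, fun _ _ h => h⟩,
      ⟨hy, le_rfl, fun _ _ h => h⟩, hM, fun a b a' b' ha hb ha' hb' => ?_⟩
    rw [inBlock_range ha, inBlock_range hb, inBlock_range ha', inBlock_range hb']

theorem TwinOrdered.isRectUnion {n d : ℕ} {M : ℕ → ℕ → Bool} (h : TwinOrdered n n d M) :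
    IsRectUnion n (fun x y => x < n ∧ y < n ∧ M x y = true) (d * (2 * n - 2) + 1) := by
  obtain ⟨D, h0, hN, hstep, herr⟩ := h
  have hNe : (n - 1) + (n - 1) = 2 * n - 2 := by omega
  rw [hNe] at hN hstep herr
  set N := 2 * n - 2
  have hlt : ∀ k, k ≤ N → (∀ s ∈ (D k).1, s < n) ∧ (∀ s ∈ (D k).2, s < n) := by
    intro k
    induction k with
    | zero => intro _; simp [h0]
    | succ k ih =>
      intro hk
      obtain ⟨i1, i2⟩ := ih (by omega)
      rcases hstep k hk with ⟨e1, -, e2⟩ | ⟨e1, -, e2⟩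
      · exact ⟨fun s hs => i1 s (e1 hs), e2 ▸ i2⟩
      · exact ⟨e2 ▸ i1, fun s hs => i2 s (e1 hs)⟩
  have key : ∀ j, j ≤ N → 0 ∈ (D (N - j)).1 ∧ 0 ∈ (D (N - j)).2 ∧
      IsRectUnion n (ConstOnes M n (D (N - j)).1 (D (N - j)).2) (1 + d * j) := by
    intro j
    induction j with
    | zero =>
      intro _
      simpa [hN] using isRectUnion_constOnes_coarsest M n
    | succ j ih =>
      intro hj
      obtain ⟨z1, z2, hu⟩ := ih (by omega)
      have hk : N - j = N - (j + 1) + 1 := by omega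
      rw [hk] at z1 z2 hu
      have hlt' := hlt (N - (j + 1)) (by omega)
      have hltS := hlt (N - (j + 1) + 1) (by omega)
      have herrS := herr (N - (j + 1) + 1) (by omega)
      have hstepS := hstep (N - (j + 1)) (by omega)
      have hdj : 1 + d * (j + 1) = 1 + d * j + d := by ring
      rw [hdj]
      generalize D (N - (j + 1) + 1) = E at *
      generalize D (N - (j + 1)) = E' at *
      rcases hstepS with ⟨e1, e2, e3⟩ | ⟨e1, e2, e3⟩
      · rw [← e3]
        exact ⟨e1 z1, z2, hu.constOnes_split_rows ⟨e1 z1, hlt'.1⟩ ⟨z1, hltS.1⟩ ⟨z2, hltS.2⟩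
          e1 e2 herrS.1⟩
      · rw [← e3]
        refine ⟨z1, e1 z2, ?_⟩
        have hu' : IsRectUnion n (ConstOnes (fun x y => M y x) n E.2 E.1) (1 + d * j) :=
          hu.swap.congr fun x y => (constOnes_transpose M n E.1 E.2 y x).symm
        refine (IsRectUnion.constOnes_split_rows (R' := E'.2) ⟨e1 z2, hlt'.2⟩ ⟨z2, hltS.2⟩
          ⟨z1, hltS.1⟩ e1 e2 ?_ hu').swap.congr fun x y => constOnes_transpose M n E.1 E'.2 x y
        simpa only [isConst_transpose] using herrS.2
  have hfin := (key N le_rfl).2.2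
  rw [Nat.sub_self, h0, add_comm] at hfin
  exact hfin.congr fun x y => constOnes_finest

/-- Every `n × n` binary matrix that is `d`-twin-ordered admits a rectangle decomposition
with at most `d * (2n - 2) + 1` rectangles: pairwise disjoint rectangles, each entirely
filled with `1`s, covering all the `1` entries of the matrix. -/
theorem rectangle_decomposition (n d : ℕ) (M : ℕ → ℕ → Bool)
    (h : TwinOrdered n n d M) :
    ∃ K : Finset (ℕ × ℕ × ℕ × ℕ),
      (∀ q ∈ K, q.1 ≤ q.2.1 ∧ q.2.1 < n ∧ q.2.2.1 ≤ q.2.2.2 ∧ q.2.2.2 < n) ∧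
      (∀ q ∈ K, ∀ x y, InRect q x y → M x y = true) ∧
      (∀ q ∈ K, ∀ q' ∈ K, q ≠ q' → ∀ x y, ¬(InRect q x y ∧ InRect q' x y)) ∧
      (∀ x y, x < n → y < n → M x y = true → ∃ q ∈ K, InRect q x y) ∧
      K.card ≤ d * (2 * n - 2) + 1 := by
  obtain ⟨K, h1, h2, h3, h4⟩ := h.isRectUnion
  exact ⟨K, h1, fun q hq x y hxy => ((h3 x y).2 ⟨q, hq, hxy⟩).2.2, h2,
    fun x y hx hy hM => (h3 x y).1 ⟨hx, hy, hM⟩, h4⟩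
end

section
/- Let M be a binary matrix, let D be a non-constant vertical submatrix of M, and let C be a non-mixed submatrix of M occupying the same columns as D and whose rows are exactly the rows immediately above those of D. If the union of C and D (the submatrix spanning the rows of C and D and their common columns) is not vertical, then there is a corner of M contained in the union of the bottom-most row of C and the top-most row of D. -/
theorem corner_of_ne (M : ℕ → ℕ → Bool) (r c : ℕ)
    (hne : ¬ (M r c = M r (c + 1) ∧ M (r + 1) c = M (r + 1) (c + 1)))
    (hne' : ¬ (M r c = M (r + 1) c ∧ M r (c + 1) = M (r + 1) (c + 1))) : Corner M r c :=
  ⟨fun h => hne ⟨h _ _ _ (Or.inl rfl) (Or.inl rfl) (Or.inr rfl),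
      h _ _ _ (Or.inr rfl) (Or.inl rfl) (Or.inr rfl)⟩,
    fun h => hne' ⟨h _ _ _ (Or.inl rfl) (Or.inr rfl) (Or.inl rfl),
      h _ _ _ (Or.inl rfl) (Or.inr rfl) (Or.inr rfl)⟩⟩

/-- Two consecutive rows without corners either agree, or differ everywhere and are constant. -/
theorem eq_or_const_of_forall_not_corner (M : ℕ → ℕ → Bool) (r c1 c2 : ℕ)
    (h : ∀ c, c1 ≤ c → c + 1 ≤ c2 → ¬ Corner M r c) :
    (∀ y, c1 ≤ y → y ≤ c2 → M r y = M (r + 1) y) ∨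
      ∀ y, c1 ≤ y → y ≤ c2 → M (r + 1) y = M (r + 1) c1 := by
  have key : ∀ y, c1 ≤ y → y ≤ c2 → (M r y = M (r + 1) y ↔ M r c1 = M (r + 1) c1) ∧
      (M r c1 ≠ M (r + 1) c1 → M (r + 1) y = M (r + 1) c1) := by
    intro y hy
    induction y, hy using Nat.le_induction with
    | base => simp
    | succ y hy ih =>
      intro hy2
      have ih := ih (by omega)
      have hc := fun h₁ h₂ => h y hy hy2 (corner_of_ne M r y h₁ h₂)
      grind
  by_cases h0 : M r c1 = M (r + 1) c1
  · exact Or.inl fun y hy hy' => (key y hy hy').1.2 h0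
  · exact Or.inr fun y hy hy' => (key y hy hy').2 h0

/-- Let `D` be the non-constant vertical submatrix of `M` on rows `[r2+1, r3]` and columns
`[c1, c2]`, and let `C` be the non-mixed submatrix on rows `[r1, r2]` (immediately above
`D`) and the same columns. If the union of `C` and `D` (rows `[r1, r3]`, columns
`[c1, c2]`) is not vertical, then there is a corner of `M` contained in the union of the
bottom-most row of `C` (row `r2`) and the top-most row of `D` (row `r2 + 1`). -/
theorem corner_in_union_of_boundary_rows (M : ℕ → ℕ → Bool) (r1 r2 r3 c1 c2 : ℕ)
    (hr1 : r1 ≤ r2) (hr2 : r2 < r3) (hc : c1 ≤ c2)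
    (hDvert : IsVert M (fun x => r2 + 1 ≤ x ∧ x ≤ r3) (fun y => c1 ≤ y ∧ y ≤ c2))
    (hDnc : ¬ IsConst M (fun x => r2 + 1 ≤ x ∧ x ≤ r3) (fun y => c1 ≤ y ∧ y ≤ c2))
    (hCnm : ¬ IsMixed M (fun x => r1 ≤ x ∧ x ≤ r2) (fun y => c1 ≤ y ∧ y ≤ c2))
    (hU : ¬ IsVert M (fun x => r1 ≤ x ∧ x ≤ r3) (fun y => c1 ≤ y ∧ y ≤ c2)) :
    ∃ c, c1 ≤ c ∧ c + 1 ≤ c2 ∧ Corner M r2 c := by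
  by_contra! hcor
  have hD : ∀ x y, r2 + 1 ≤ x → x ≤ r3 → c1 ≤ y → y ≤ c2 → M x y = M (r2 + 1) y :=
    fun x y hx hx' hy hy' => hDvert _ _ _ ⟨hx, hx'⟩ ⟨le_rfl, hr2⟩ ⟨hy, hy'⟩
  have hnc : ¬ ∀ y, c1 ≤ y → y ≤ c2 → M (r2 + 1) y = M (r2 + 1) c1 := by
    intro h
    apply hDnc
    rintro x y x' y' ⟨hx, hx'⟩ ⟨hy, hy'⟩ ⟨hz, hz'⟩ ⟨hw, hw'⟩
    rw [hD x y hx hx' hy hy', hD x' y' hz hz' hw hw', h y hy hy', h y' hw hw']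
  have heq := (eq_or_const_of_forall_not_corner M r2 c1 c2 hcor).resolve_right hnc
  apply hCnm
  constructor
  · intro hh
    apply hnc
    intro y hy hy'
    rw [← heq y hy hy', ← heq c1 le_rfl hc]
    exact hh _ _ _ ⟨hr1, le_rfl⟩ ⟨hy, hy'⟩ ⟨le_rfl, hc⟩
  · intro hv
    apply hU
    have hall : ∀ x y, r1 ≤ x → x ≤ r3 → c1 ≤ y → y ≤ c2 → M x y = M r2 y := by
      intro x y hx hx' hy hy'
      rcases Nat.lt_or_ge r2 x with hlt | hle
      · rw [hD x y hlt hx' hy hy', heq y hy hy']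
      · exact hv _ _ _ ⟨hx, hle⟩ ⟨hr1, le_rfl⟩ ⟨hy, hy'⟩
    rintro x x' y ⟨hx, hx'⟩ ⟨hz, hz'⟩ ⟨hy, hy'⟩
    rw [hall x y hx hx' hy hy', hall x' y hz hz' hy hy']
end

section
/- For every d ∈ ℕ there exists a constant α_d such that the following holds: if M is an n×n binary matrix that is d-twin-ordered, then for every s ∈ {1,...,n}, the cardinality of the s-zone family F_s(M) is at most α_d·(n/s). -/
/-- The zone of the `s`-regular division of the `n × n` matrix `M` in the intersection of
the `(i+1)`-st row block and the `(j+1)`-st column block, recorded as a triple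
(number of rows, number of columns, normalized entry function). -/
def zoneOf (M : ℕ → ℕ → Bool) (n s i j : ℕ) : ℕ × ℕ × (ℕ → ℕ → Bool) :=
  (min s (n - i * s), min s (n - j * s),
    fun x y =>
      if x < min s (n - i * s) ∧ y < min s (n - j * s) then M (i * s + x) (j * s + y)
      else false)

/-- The `s`-zone family of the `n × n` matrix `M`: the set of distinct matrices occurring
as zones of the `s`-regular division of `M` (equal zones counted once). -/
def ZoneFamily (M : ℕ → ℕ → Bool) (n s : ℕ) : Set (ℕ × ℕ × (ℕ → ℕ → Bool)) :=
  {z | ∃ i j : ℕ, i < (n + s - 1) / s ∧ j < (n + s - 1) / s ∧ z = zoneOf M n s i j}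

/-- The `s × s` zone with upper left corner `(i * s, j * s)`, with normalized entries. -/
def fullZone (M : ℕ → ℕ → Bool) (s i j : ℕ) : ℕ → ℕ → Bool :=
  fun x y => if x < s ∧ y < s then M (i * s + x) (j * s + y) else false

theorem fullZone_transpose (M : ℕ → ℕ → Bool) (s i j : ℕ) :
    (fun x y => fullZone (fun x y => M y x) s j i y x) = fullZone M s i j := by
  funext x y
  simp [fullZone, and_comm]

theorem zoneOf_eq_fullZone {M : ℕ → ℕ → Bool} {n s q i j : ℕ} (hq : q * s ≤ n)
    (hi : i < q) (hj : j < q) : zoneOf M n s i j = (s, s, fullZone M s i j) := by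
  have key : ∀ i < q, min s (n - i * s) = s := by
    intro i hi
    have : (i + 1) * s ≤ q * s := Nat.mul_le_mul_right s hi
    rw [Nat.add_mul] at this
    omega
  simp only [zoneOf, key i hi, key j hj]
  rfl

theorem ErrorValueLe.transpose {M : ℕ → ℕ → Bool} {n m d : ℕ} {R C : Finset ℕ}
    (h : ErrorValueLe M n m R C d) : ErrorValueLe (fun x y => M y x) m n C R d := by
  have key : ∀ P Q : ℕ → Prop, IsConst (fun x y => M y x) Q P ↔ IsConst M P Q := fun P Q =>
    ⟨fun h x y x' y' hx hy hx' hy' => h y x y' x' hy hx hy' hx',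
      fun h x y x' y' hx hy hx' hy' => h y x y' x' hy hx hy' hx'⟩
  simpa only [ErrorValueLe, key] using And.symm h

/-- A contraction sequence, extended to be eventually constant, as a pair of antitone sequences
of sets of block starts. -/
theorem TwinOrdered.exists_antitone {n d : ℕ} {M : ℕ → ℕ → Bool} (hM : TwinOrdered n n d M) :
    ∃ R C : ℕ → Finset ℕ, Antitone R ∧ Antitone C ∧ (∀ k, 0 ∈ R k) ∧ (∀ k, 0 ∈ C k) ∧
      R 0 = Finset.range n ∧ C 0 = Finset.range n ∧
      (∀ k, R (k + 1) = R k ∨ C (k + 1) = C k) ∧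
      (∀ k, ErrorValueLe M n n (R k) (C k) d) ∧ (∃ k, R k = {0}) ∧ (∃ k, C k = {0}) := by
  obtain ⟨D, h0, hend, hstep, herr⟩ := hM
  set K := (n - 1) + (n - 1)
  have hstep' : ∀ k, ((D (min (k + 1) K)).1 ⊆ (D (min k K)).1 ∧
      (D (min (k + 1) K)).2 ⊆ (D (min k K)).2) ∧
      ((D (min (k + 1) K)).1 = (D (min k K)).1 ∨ (D (min (k + 1) K)).2 = (D (min k K)).2) := by
    intro k
    rcases lt_or_ge k K with hk | hk
    · rw [min_eq_left (by omega : k + 1 ≤ K), min_eq_left hk.le]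
      rcases hstep k hk with ⟨h₁, -, h₂⟩ | ⟨h₁, -, h₂⟩
      · exact ⟨⟨h₁, h₂.le⟩, Or.inr h₂⟩
      · exact ⟨⟨h₂.le, h₁⟩, Or.inl h₂⟩
    · rw [min_eq_right (by omega : K ≤ k + 1), min_eq_right hk]
      exact ⟨⟨subset_rfl, subset_rfl⟩, Or.inl rfl⟩
  have hRa : Antitone fun k => (D (min k K)).1 := antitone_nat_of_succ_le fun k => (hstep' k).1.1
  have hCa : Antitone fun k => (D (min k K)).2 := antitone_nat_of_succ_le fun k => (hstep' k).1.2
  have hlast : ∀ k, K ≤ k → D (min k K) = ({0}, {0}) := fun k hk => by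
    rw [min_eq_right hk]; exact hend
  refine ⟨fun k => (D (min k K)).1, fun k => (D (min k K)).2, hRa, hCa, fun k => ?_, fun k => ?_,
    by simp [h0], by simp [h0], fun k => (hstep' k).2, fun k => herr _ (min_le_right _ _),
    ⟨K, by simp [hend]⟩, ⟨K, by simp [hend]⟩⟩
  · have h : (D (min (max k K) K)).1 ⊆ (D (min k K)).1 := hRa (le_max_left k K)
    rw [hlast _ (le_max_right _ _)] at h
    exact h (Finset.mem_singleton_self 0)
  · have h : (D (min (max k K) K)).2 ⊆ (D (min k K)).2 := hCa (le_max_left k K)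
    rw [hlast _ (le_max_right _ _)] at h
    exact h (Finset.mem_singleton_self 0)

/-- No block start of `S` lies strictly inside `[a, b)`: the interval is contained in a block. -/
def Unsplit (S : Finset ℕ) (a b : ℕ) : Prop :=
  ∀ t ∈ S, t ≤ a ∨ b ≤ t

/-- The first time at which `w` consecutive regular blocks of size `s`, starting from the `i`-th,
are contained in a single block. -/
noncomputable def firstUnsplit (S : ℕ → Finset ℕ) (s i w : ℕ) : ℕ :=
  sInf {k | Unsplit (S k) (i * s) ((i + w) * s)}

section firstUnsplit

variable {S : ℕ → Finset ℕ} {s i w k : ℕ}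

theorem unsplit_firstUnsplit (h : ∃ k, S k = {0}) :
    Unsplit (S (firstUnsplit S s i w)) (i * s) ((i + w) * s) := by
  obtain ⟨k, hk⟩ := h
  refine Nat.sInf_mem (s := {k | Unsplit (S k) (i * s) ((i + w) * s)}) ⟨k, ?_⟩
  intro t ht
  rw [hk, Finset.mem_singleton] at ht
  omega

theorem firstUnsplit_le (h : Unsplit (S k) (i * s) ((i + w) * s)) : firstUnsplit S s i w ≤ k :=
  Nat.sInf_le h

theorem firstUnsplit_le_iff (hS : Antitone S) (h : ∃ k, S k = {0}) :
    firstUnsplit S s i w ≤ k ↔ Unsplit (S k) (i * s) ((i + w) * s) :=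
  ⟨fun hk t ht => unsplit_firstUnsplit h t (hS hk ht), firstUnsplit_le⟩

end firstUnsplit

/-- The start of the block of `x`. -/
def blockStart (S : Finset ℕ) (x : ℕ) : ℕ :=
  (S.filter (· ≤ x)).sup id

theorem le_blockStart {S : Finset ℕ} {t x : ℕ} (ht : t ∈ S) (htx : t ≤ x) : t ≤ blockStart S x :=
  Finset.le_sup (f := id) (Finset.mem_filter.2 ⟨ht, htx⟩)

theorem blockStart_le (S : Finset ℕ) (x : ℕ) : blockStart S x ≤ x :=
  Finset.sup_le fun _ ht => (Finset.mem_filter.1 ht).2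

theorem blockStart_mem {S : Finset ℕ} (h0 : 0 ∈ S) (x : ℕ) : blockStart S x ∈ S := by
  obtain ⟨t, ht, hx⟩ := Finset.exists_mem_eq_sup (S.filter (· ≤ x)) ⟨0, by simp [h0]⟩ id
  rw [blockStart, hx]
  exact (Finset.mem_filter.1 ht).1

theorem inBlock_blockStart {S : Finset ℕ} {n x : ℕ} (hx : x < n) :
    InBlock S n (blockStart S x) x :=
  ⟨hx, blockStart_le S x, fun _ => le_blockStart⟩

theorem Unsplit.inBlock {S : Finset ℕ} {n a b x : ℕ} (h : Unsplit S a b) (hax : a ≤ x)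
    (hxb : x < b) (hx : x < n) : InBlock S n (blockStart S a) x := by
  refine ⟨hx, (blockStart_le S a).trans hax, fun t ht htx => le_blockStart ht ?_⟩
  rcases h t ht with h | h <;> omega

/-- At most two regular blocks meet a given block without being contained in it. -/
theorem eq_or_eq_of_not_unsplit {S : Finset ℕ} {s j y : ℕ} (hy : y < s)
    (h : ¬ Unsplit S (j * s) ((j + 1) * s)) :
    j = blockStart S (j * s + y) / s ∨
      j = sInf {t | t ∈ S ∧ blockStart S (j * s + y) < t} / s := by
  rw [Nat.add_mul] at h
  set c := blockStart S (j * s + y) with hc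
  have hcle : c ≤ j * s + y := blockStart_le _ _
  rcases le_or_gt (j * s) c with hjc | hjc
  · left
    exact (Nat.div_eq_of_lt_le hjc (by rw [Nat.add_mul]; omega)).symm
  · right
    simp only [Unsplit, not_forall, not_or, not_le] at h
    obtain ⟨t, ht, h₁, h₂⟩ := h
    have hmem := Nat.sInf_mem (s := {t | t ∈ S ∧ c < t}) ⟨t, ht, by omega⟩
    have hle := Nat.sInf_le (s := {t | t ∈ S ∧ c < t}) (m := t) ⟨ht, by omega⟩
    set u := sInf {t | t ∈ S ∧ c < t}
    have hu : ¬ u ≤ j * s + y := fun h => absurd (le_blockStart hmem.1 h) (not_le.2 hmem.2)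
    exact (Nat.div_eq_of_lt_le (by omega) (by rw [Nat.add_mul]; omega)).symm

section counting

variable {M : ℕ → ℕ → Bool} {n s q d : ℕ} {R C : ℕ → Finset ℕ}

open Classical in
/-- If the `i`-th and `(i+1)`-st regular row blocks get into a common row block before the `j`-th
regular column block gets into a column block, then their zones in the `j`-th column agree
for all but `2 * d` such `j`. -/
theorem card_fullZone_ne_succ_le (hq : q * s ≤ n)
    (hCa : Antitone C) (hR : ∀ k, 0 ∈ R k) (hC : ∀ k, 0 ∈ C k)
    (herr : ∀ k, ErrorValueLe M n n (R k) (C k) d)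
    (hRend : ∃ k, R k = {0}) (hCend : ∃ k, C k = {0}) {i : ℕ} (hi : i + 1 < q) :
    ((Finset.range q).filter fun j => firstUnsplit R s i 2 < firstUnsplit C s j 1 ∧
      fullZone M s i j ≠ fullZone M s (i + 1) j).card ≤ 2 * d := by
  set k := firstUnsplit R s i 2
  set b := blockStart (R k) (i * s)
  let T := (C k).filter fun c => ¬ IsConst M (InBlock (R k) n b) (InBlock (C k) n c)
  have hT : T.card ≤ d := by
    have := (herr k).1 b (blockStart_mem (hR k) _)
    rwa [← Set.ncard_coe_finset, Finset.coe_filter]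
  refine (Finset.card_le_card (t := T.image (fun c => c / s) ∪
    T.image (fun c => sInf {t | t ∈ C k ∧ c < t} / s)) ?_).trans
    ((Finset.card_union_le _ _).trans ?_)
  · intro j hj
    obtain ⟨hjq, hlt, hne⟩ := by simpa only [Finset.mem_filter, Finset.mem_range] using hj
    obtain ⟨x, y, hx, hy, hxy⟩ : ∃ x y, x < s ∧ y < s ∧
        M (i * s + x) (j * s + y) ≠ M ((i + 1) * s + x) (j * s + y) := by
      by_contra! hcon
      refine hne (funext₂ fun x y => ?_)
      unfold fullZone
      split_ifs with h
      · exact hcon x y h.1 h.2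
      · rfl
    have hi2 : (i + 2) * s ≤ q * s := Nat.mul_le_mul_right s hi
    have hj1 : (j + 1) * s ≤ q * s := Nat.mul_le_mul_right s hjq
    have hun : Unsplit (R k) (i * s) ((i + 2) * s) := unsplit_firstUnsplit hRend
    have hcT : blockStart (C k) (j * s + y) ∈ T := by
      refine Finset.mem_filter.2 ⟨blockStart_mem (hC k) _, fun hconst => hxy ?_⟩
      rw [Nat.add_mul] at hj1
      have hyb := inBlock_blockStart (S := C k) (n := n) (x := j * s + y) (by omega)
      rw [Nat.add_mul] at hi2
      refine hconst _ _ _ _ (hun.inBlock ?_ ?_ ?_) hyb (hun.inBlock ?_ ?_ ?_) hyb <;>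
        (try simp only [Nat.add_mul]) <;> omega
    have hns : ¬ Unsplit (C k) (j * s) ((j + 1) * s) := fun h =>
      absurd ((firstUnsplit_le_iff hCa hCend).2 h) (not_le.2 hlt)
    rcases eq_or_eq_of_not_unsplit hy hns with h | h
    · exact Finset.mem_union_left _ (Finset.mem_image.2 ⟨_, hcT, h.symm⟩)
    · exact Finset.mem_union_right _ (Finset.mem_image.2 ⟨_, hcT, h.symm⟩)
  · have h₁ : (T.image (fun c => c / s)).card ≤ T.card := Finset.card_image_le
    have h₂ : (T.image (fun c => sInf {t | t ∈ C k ∧ c < t} / s)).card ≤ T.card :=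
      Finset.card_image_le
    omega

open Classical in
/-- When the `j`-th regular column block gets into a column block, at most `d` row blocks end
with (a part following) a regular row block whose zone in the `j`-th column is not constant. -/
theorem card_not_const_last_le (hq : q * s ≤ n) (hRa : Antitone R)
    (hR : ∀ k, 0 ∈ R k) (hC : ∀ k, 0 ∈ C k)
    (herr : ∀ k, ErrorValueLe M n n (R k) (C k) d)
    (hRend : ∃ k, R k = {0}) (hCend : ∃ k, C k = {0}) {j : ℕ} (hj : j < q) :
    ((Finset.range q).filter fun i => firstUnsplit R s i 1 ≤ firstUnsplit C s j 1 ∧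
      firstUnsplit C s j 1 < firstUnsplit R s i 2 ∧
      ∀ b : Bool, fullZone M s i j ≠ fullZone (fun _ _ => b) s 0 0).card ≤ d := by
  set k := firstUnsplit C s j 1
  set c := blockStart (C k) (j * s)
  let T := (R k).filter fun b => ¬ IsConst M (InBlock (R k) n b) (InBlock (C k) n c)
  have hT : T.card ≤ d := by
    have := (herr k).2 c (blockStart_mem (hC k) _)
    rwa [← Set.ncard_coe_finset, Finset.coe_filter]
  have hinj : ∀ i i', i < i' → firstUnsplit R s i' 1 ≤ k → k < firstUnsplit R s i 2 →
      blockStart (R k) (i * s) ≠ blockStart (R k) (i' * s) := by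
    intro i i' hii hi' hi heq
    have hns : ¬ Unsplit (R k) (i * s) ((i + 2) * s) := fun h =>
      absurd ((firstUnsplit_le_iff hRa hRend).2 h) (not_le.2 hi)
    simp only [Unsplit, not_forall, not_or, not_le] at hns
    obtain ⟨t, ht, h₁, h₂⟩ := hns
    have hle : (i + 2) * s ≤ (i' + 1) * s := Nat.mul_le_mul_right s (by omega)
    rcases (firstUnsplit_le_iff hRa hRend).1 hi' t ht with h | h
    · have h₃ := le_blockStart ht h
      have h₄ := blockStart_le (R k) (i * s)
      omega
    · omega
  refine (Finset.card_le_card_of_injOn (t := T) (fun i => blockStart (R k) (i * s)) ?_ ?_).trans hT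
  · intro i hi
    obtain ⟨hiq, hle, -, hne⟩ := by
      simpa only [Finset.coe_filter, Set.mem_ofPred_eq, Finset.mem_range] using hi
    refine Finset.mem_filter.2 ⟨blockStart_mem (hR k) _, fun hconst => ?_⟩
    refine hne (M (i * s) (j * s)) (funext₂ fun x y => ?_)
    have hi1 : (i + 1) * s ≤ q * s := Nat.mul_le_mul_right s hiq
    have hj1 : (j + 1) * s ≤ q * s := Nat.mul_le_mul_right s hj
    have hui := (firstUnsplit_le_iff hRa hRend).1 hle
    have huj : Unsplit (C k) (j * s) ((j + 1) * s) := unsplit_firstUnsplit hCend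
    rw [Nat.add_mul] at hi1 hj1 hui huj
    unfold fullZone
    split_ifs with h
    · obtain ⟨hx, hy⟩ := h
      refine hconst _ _ _ _ (hui.inBlock ?_ ?_ ?_) (huj.inBlock ?_ ?_ ?_)
        (hui.inBlock ?_ ?_ ?_) (huj.inBlock ?_ ?_ ?_) <;> omega
    · rfl
  · intro i hi i' hi' heq
    obtain ⟨-, hle, hlt, -⟩ := by
      simpa only [Finset.coe_filter, Set.mem_ofPred_eq, Finset.mem_range] using hi
    obtain ⟨-, hle', hlt', -⟩ := by
      simpa only [Finset.coe_filter, Set.mem_ofPred_eq, Finset.mem_range] using hi'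
    rcases lt_trichotomy i i' with h | h | h
    · exact absurd heq (hinj i i' h hle' hlt)
    · exact h
    · exact absurd heq.symm (hinj i' i h hle hlt')

theorem firstUnsplit_ne (hs : 1 ≤ s) (hq : q * s ≤ n) (hR0 : R 0 = Finset.range n)
    (hRa : Antitone R) (hCa : Antitone C)
    (hstep : ∀ k, R (k + 1) = R k ∨ C (k + 1) = C k)
    (hRend : ∃ k, R k = {0}) (hCend : ∃ k, C k = {0}) {i j : ℕ} (hi : i + 1 < q) :
    firstUnsplit R s i 2 ≠ firstUnsplit C s j 1 := by
  intro heq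
  have hR := (firstUnsplit_le_iff (s := s) (i := i) (w := 2) hRa hRend).1 le_rfl
  have hC := (firstUnsplit_le_iff (s := s) (i := j) (w := 1) hCa hCend).1 le_rfl
  rcases hk : firstUnsplit R s i 2 with _ | k
  · have hi2 : (i + 2) * s ≤ q * s := Nat.mul_le_mul_right s hi
    rw [hk, hR0] at hR
    rw [Nat.add_mul] at hR hi2
    have := hR (i * s + 1) (Finset.mem_range.2 (by omega))
    omega
  · rcases hstep k with h | h
    · rw [hk, h] at hR
      have := firstUnsplit_le hR
      omega
    · rw [← heq, hk, h] at hC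
      have := firstUnsplit_le hC
      omega

open Classical in
/-- There are linearly many distinct full zones whose rows get into a common row block no later
than their columns get into a common column block. -/
theorem card_image_fullZone_le (hs : 1 ≤ s) (hq : q * s ≤ n)
    (hRa : Antitone R) (hCa : Antitone C) (hR : ∀ k, 0 ∈ R k) (hC : ∀ k, 0 ∈ C k)
    (hR0 : R 0 = Finset.range n)
    (hstep : ∀ k, R (k + 1) = R k ∨ C (k + 1) = C k)
    (herr : ∀ k, ErrorValueLe M n n (R k) (C k) d)
    (hRend : ∃ k, R k = {0}) (hCend : ∃ k, C k = {0}) :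
    (((Finset.range q ×ˢ Finset.range q).filter
      (fun p => firstUnsplit R s p.1 1 ≤ firstUnsplit C s p.2 1)).image
        (fun p => fullZone M s p.1 p.2)).card ≤ (3 * d + 1) * q + 2 := by
  let Ea := (Finset.range q).image fun j => fullZone M s (q - 1) j
  let Eb := (Finset.range (q - 1)).biUnion fun i =>
    ((Finset.range q).filter fun j => firstUnsplit R s i 2 < firstUnsplit C s j 1 ∧
      fullZone M s i j ≠ fullZone M s (i + 1) j).image fun j => fullZone M s i j
  let Ec := (Finset.univ : Finset Bool).image fun b => fullZone (fun _ _ => b) s 0 0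
  let Ed := (Finset.range q).biUnion fun j =>
    ((Finset.range q).filter fun i => firstUnsplit R s i 1 ≤ firstUnsplit C s j 1 ∧
      firstUnsplit C s j 1 < firstUnsplit R s i 2 ∧
      ∀ b : Bool, fullZone M s i j ≠ fullZone (fun _ _ => b) s 0 0).image
        fun i => fullZone M s i j
  have hcover : ∀ m i j, i + 1 + m = q → j < q →
      firstUnsplit R s i 1 ≤ firstUnsplit C s j 1 → fullZone M s i j ∈ Ea ∪ Eb ∪ Ec ∪ Ed := by
    intro m
    induction m with
    | zero =>
      intro i j hi hj hle
      simp only [Finset.mem_union]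
      refine Or.inl (Or.inl (Or.inl (Finset.mem_image.2 ⟨j, Finset.mem_range.2 hj, ?_⟩)))
      rw [show q - 1 = i by omega]
    | succ m ih =>
      intro i j hi hj hle
      rcases lt_or_gt_of_ne (firstUnsplit_ne hs hq hR0 hRa hCa hstep hRend hCend
        (i := i) (j := j) (by omega)) with h | h
      · by_cases hne : fullZone M s i j = fullZone M s (i + 1) j
        · rw [hne]
          refine ih (i + 1) j (by omega) hj (le_trans (firstUnsplit_le fun t ht => ?_) h.le)
          have := (firstUnsplit_le_iff (s := s) (i := i) (w := 2) hRa hRend).1 le_rfl t ht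
          simp only [Nat.add_mul] at this ⊢
          omega
        · simp only [Finset.mem_union]
          refine Or.inl (Or.inl (Or.inr (Finset.mem_biUnion.2
            ⟨i, Finset.mem_range.2 (by omega), Finset.mem_image.2 ⟨j, ?_, rfl⟩⟩)))
          exact Finset.mem_filter.2 ⟨Finset.mem_range.2 hj, h, hne⟩
      · simp only [Finset.mem_union]
        by_cases hb : ∃ b : Bool, fullZone M s i j = fullZone (fun _ _ => b) s 0 0
        · obtain ⟨b, hb⟩ := hb
          exact Or.inl (Or.inr (Finset.mem_image.2 ⟨b, Finset.mem_univ b, hb.symm⟩))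
        · refine Or.inr (Finset.mem_biUnion.2
            ⟨j, Finset.mem_range.2 hj, Finset.mem_image.2 ⟨i, ?_, rfl⟩⟩)
          exact Finset.mem_filter.2 ⟨Finset.mem_range.2 (by omega), hle, h, not_exists.1 hb⟩
  have hsub : ((Finset.range q ×ˢ Finset.range q).filter
      (fun p => firstUnsplit R s p.1 1 ≤ firstUnsplit C s p.2 1)).image
        (fun p => fullZone M s p.1 p.2) ⊆ Ea ∪ Eb ∪ Ec ∪ Ed := by
    intro z hz
    obtain ⟨⟨i, j⟩, hp, rfl⟩ := Finset.mem_image.1 hz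
    obtain ⟨⟨hi, hj⟩, hle⟩ := by
      simpa only [Finset.mem_filter, Finset.mem_product, Finset.mem_range] using hp
    exact hcover (q - 1 - i) i j (by omega) hj hle
  have ha : Ea.card ≤ q := Finset.card_image_le.trans (by simp)
  have hb : Eb.card ≤ (q - 1) * (2 * d) := by
    refine (Finset.card_biUnion_le_card_mul _ _ (2 * d) fun i hi => ?_).trans (by simp)
    have hi' := Finset.mem_range.1 hi
    exact Finset.card_image_le.trans
      (card_fullZone_ne_succ_le hq hCa hR hC herr hRend hCend (by omega))
  have hc : Ec.card ≤ 2 := Finset.card_image_le.trans (by simp)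
  have hd : Ed.card ≤ q * d := by
    refine (Finset.card_biUnion_le_card_mul _ _ d fun j hj => ?_).trans (by simp)
    exact Finset.card_image_le.trans
      (card_not_const_last_le hq hRa hR hC herr hRend hCend (Finset.mem_range.1 hj))
  have hb' : (q - 1) * (2 * d) ≤ q * (2 * d) := Nat.mul_le_mul_right _ (Nat.sub_le q 1)
  have hu := (Finset.card_le_card hsub).trans ((Finset.card_union_le _ _).trans
    (Nat.add_le_add_right ((Finset.card_union_le _ _).trans
      (Nat.add_le_add_right (Finset.card_union_le _ _) _)) _))
  nlinarith

end counting

/-- For every `d` there is a constant `α` such that for every `n × n` binary matrix `M`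
that is `d`-twin-ordered and every `s ∈ {1, …, n}`, the `s`-zone family of `M` has
cardinality at most `α * (n / s)`. -/
theorem zone_family_linear_bound (d : ℕ) :
    ∃ α : ℕ, ∀ n : ℕ, ∀ M : ℕ → ℕ → Bool,
      TwinOrdered n n d M →
      ∀ s : ℕ, 1 ≤ s → s ≤ n → (ZoneFamily M n s).ncard ≤ α * (n / s) := by
  classical
  refine ⟨6 * d + 10, fun n M hM s hs hsn => ?_⟩
  have hq1 : 1 ≤ n / s := (Nat.one_le_div_iff (by omega)).2 hsn
  set q := n / s with hq
  have hqn : q * s ≤ n := Nat.div_mul_le_self n s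
  have hN : (n + s - 1) / s ≤ q + 1 := by
    rw [hq, ← Nat.add_div_right n (by omega)]
    exact Nat.div_le_div_right (by omega)
  obtain ⟨R, C, hRa, hCa, hR, hC, hR0, hC0, hstep, herr, hRend, hCend⟩ := hM.exists_antitone
  have h₁ := card_image_fullZone_le hs hqn hRa hCa hR hC hR0 hstep herr hRend hCend
  have h₂ := card_image_fullZone_le hs hqn hCa hRa hC hR hC0 (fun k => (hstep k).symm)
    (fun k => (herr k).transpose) hCend hRend
  set A := ((Finset.range q ×ˢ Finset.range q).filter
    (fun p => firstUnsplit R s p.1 1 ≤ firstUnsplit C s p.2 1)).image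
      (fun p => fullZone M s p.1 p.2)
  set B := ((Finset.range q ×ˢ Finset.range q).filter
    (fun p => firstUnsplit C s p.1 1 ≤ firstUnsplit R s p.2 1)).image
      (fun p => fullZone (fun x y => M y x) s p.1 p.2)
  let F := A.image (fun f => (s, s, f)) ∪ B.image (fun f => (s, s, fun x y => f y x)) ∪
    (Finset.range (q + 1)).image (fun j => zoneOf M n s q j) ∪
    (Finset.range (q + 1)).image (fun i => zoneOf M n s i q)
  have hsub : ZoneFamily M n s ⊆ (F : Set _) := by
    rintro z ⟨i, j, hi, hj, rfl⟩
    simp only [F, Finset.coe_union, Set.mem_union, Finset.mem_coe]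
    by_cases hiq : i = q
    · exact Or.inl (Or.inr (Finset.mem_image.2 ⟨j, by simp; omega, by rw [hiq]⟩))
    by_cases hjq : j = q
    · exact Or.inr (Finset.mem_image.2 ⟨i, by simp; omega, by rw [hjq]⟩)
    have hi' : i < q := by omega
    have hj' : j < q := by omega
    rw [zoneOf_eq_fullZone hqn hi' hj']
    rcases le_total (firstUnsplit R s i 1) (firstUnsplit C s j 1) with h | h
    · refine Or.inl (Or.inl (Or.inl (Finset.mem_image_of_mem _ ?_)))
      exact Finset.mem_image.2 ⟨(i, j), by simp [hi', hj', h], rfl⟩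
    · refine Or.inl (Or.inl (Or.inr (Finset.mem_image.2
        ⟨fullZone (fun x y => M y x) s j i, ?_, ?_⟩)))
      · exact Finset.mem_image.2 ⟨(j, i), by simp [hi', hj', h], rfl⟩
      · rw [fullZone_transpose]
  have hF : F.card ≤ A.card + B.card + (q + 1) + (q + 1) := by
    refine (Finset.card_union_le _ _).trans (add_le_add ((Finset.card_union_le _ _).trans
      (add_le_add ((Finset.card_union_le _ _).trans (add_le_add ?_ ?_)) ?_)) ?_)
    · exact Finset.card_image_le
    · exact Finset.card_image_le
    · exact Finset.card_image_le.trans (by simp)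
    · exact Finset.card_image_le.trans (by simp)
  have hle := Set.ncard_le_ncard hsub (Finset.finite_toSet F)
  rw [Set.ncard_coe_finset] at hle
  nlinarith
end
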